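/- Let n be an even positive integer and q ≥ 2 an integer, and set d = C(n/2 + q − 1, q − 1), the binomial coefficient. Then every ordered graph G with at most d·(n/2)^q edges admits a coloring of its edges with q colors containing no monotone path with n edges all of whose edges have the same color. -/

import Mathlib

/-- A monotone (increasing) path with `ℓ` edges in an ordered graph `G` on vertex set
`Fin n`. -/
def IsMonoPath {n ℓ : ℕ} (G : SimpleGraph (Fin n)) (v : Fin (ℓ + 1) → Fin n) : Prop :=
  StrictMono v ∧ ∀ i : Fin ℓ, G.Adj (v i.castSucc) (v i.succ)

open Finset

/-- The neighbours of `v` that precede `v`. -/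
noncomputable def backNeighbors {N : ℕ} (G : SimpleGraph (Fin N)) (v : Fin N) : Finset (Fin N) :=
  open Classical in {u | u < v ∧ G.Adj u v}

lemma mem_backNeighbors {N : ℕ} {G : SimpleGraph (Fin N)} {u v : Fin N} :
    u ∈ backNeighbors G v ↔ u < v ∧ G.Adj u v := by
  simp [backNeighbors]

lemma sum_card_backNeighbors_le {N : ℕ} (G : SimpleGraph (Fin N)) :
    ∑ v, #(backNeighbors G v) ≤ G.edgeSet.ncard := by
  classical
  rw [← card_sigma, Set.ncard_eq_toFinset_card']
  refine card_le_card_of_injOn (fun x => s(x.2, x.1)) ?_ ?_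
  · rintro ⟨v, u⟩ h
    simpa using (mem_backNeighbors.1 (by simpa using h)).2
  · rintro ⟨v, u⟩ h ⟨v', u'⟩ h' he
    have h1 := (mem_backNeighbors.1 (by simpa using h : u ∈ backNeighbors G v)).1
    have h2 := (mem_backNeighbors.1 (by simpa using h' : u' ∈ backNeighbors G v')).1
    simp only [Sym2.eq_iff] at he
    rcases he with ⟨rfl, rfl⟩ | ⟨rfl, rfl⟩
    · rfl
    · exact absurd h1 h2.asymm

/-- A vertex labelling in `{0, …, n - 1} ^ q` for which no edge goes weakly down yields a
`q`-colouring of the edges without a monochromatic monotone path with `n` edges. -/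
lemma exists_coloring_of_label {n q N : ℕ} (hq : 0 < q) (G : SimpleGraph (Fin N))
    (f : Fin N → Fin q → ℕ) (hlt : ∀ v i, f v i < n)
    (hf : ∀ u v, u < v → G.Adj u v → ¬ f v ≤ f u) :
    ∃ col : Fin N → Fin N → Fin q, ∀ c : Fin q,
      ¬ ∃ v : Fin (n + 1) → Fin N, IsMonoPath G v ∧
        ∀ i : Fin n, col (v i.castSucc) (v i.succ) = c := by
  have key : ∀ u v, ∃ i : Fin q, u < v → G.Adj u v → f u i < f v i := by
    intro u v
    by_cases h : u < v ∧ G.Adj u v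
    · have := hf u v h.1 h.2
      simp only [Pi.le_def, not_forall, not_le] at this
      exact this.imp fun i hi _ _ => hi
    · exact ⟨⟨0, hq⟩, fun h1 h2 => absurd ⟨h1, h2⟩ h⟩
  choose col hcol using key
  refine ⟨col, ?_⟩
  rintro c ⟨v, ⟨hv, hadj⟩, hc⟩
  have hmono : StrictMono fun i => f (v i) c := by
    refine Fin.strictMono_iff_lt_succ.2 fun i => ?_
    have := hcol _ _ (hv i.castSucc_lt_succ) (hadj i)
    rwa [hc] at this
  have hle : ∀ k (hk : k < n + 1), k ≤ f (v ⟨k, hk⟩) c := by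
    intro k
    induction k with
    | zero => simp
    | succ k ih =>
      intro hk
      have h1 := ih (by omega)
      have h2 := hmono (show (⟨k, by omega⟩ : Fin (n + 1)) < ⟨k + 1, hk⟩ from
        Fin.mk_lt_mk.2 (by omega))
      simp only at h2
      omega
  exact absurd (hle n (by omega)) (not_le.2 (hlt _ _))

/-- Greedy list colouring: every vertex either has a colour unavailable to all earlier vertices,
or has fewer earlier neighbours than available colours. -/
lemma exists_list_coloring {N : ℕ} {α : Type*} [Inhabited α] (G : SimpleGraph (Fin N))
    (C : Fin N → Finset α)
    (h : ∀ v, (∃ b ∈ C v, ∀ u < v, b ∉ C u) ∨ #(backNeighbors G v) < #(C v)) :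
    ∃ f : Fin N → α, (∀ v, f v ∈ C v) ∧ ∀ u v, u < v → G.Adj u v → f u ≠ f v := by
  classical
  have key : ∀ k ≤ N, ∃ f : Fin N → α, (∀ v : Fin N, v < k → f v ∈ C v) ∧
      ∀ u v : Fin N, v < k → u < v → G.Adj u v → f u ≠ f v := by
    intro k
    induction k with
    | zero => exact fun _ => ⟨fun _ => default, by simp, by simp⟩
    | succ k ih =>
      intro hk
      obtain ⟨f, hfC, hf⟩ := ih (by omega)
      set w : Fin N := ⟨k, hk⟩
      obtain ⟨b, hb, hbn⟩ : ∃ b ∈ C w, ∀ u < w, G.Adj u w → f u ≠ b := by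
        rcases h w with ⟨b, hb, hbn⟩ | hlt
        · exact ⟨b, hb, fun u hu _ he => hbn u hu (he ▸ hfC u hu)⟩
        · obtain ⟨b, hb, hbn⟩ := exists_mem_notMem_of_card_lt_card
            (card_image_le.trans_lt hlt : #((backNeighbors G w).image f) < _)
          exact ⟨b, hb, fun u hu hadj he =>
            hbn (mem_image.2 ⟨u, mem_backNeighbors.2 ⟨hu, hadj⟩, he⟩)⟩
      have hcase : ∀ v : Fin N, (v : ℕ) < k + 1 → v = w ∨ (v ≠ w ∧ (v : ℕ) < k) := by
        intro v hv
        by_cases hvw : v = w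
        · exact Or.inl hvw
        · have : (v : ℕ) ≠ k := fun h => hvw (Fin.ext h)
          exact Or.inr ⟨hvw, by omega⟩
      refine ⟨Function.update f w b, fun v hv => ?_, fun u v hv huv hadj => ?_⟩
      · rcases hcase v hv with rfl | ⟨hne, hv⟩
        · simpa using hb
        · simpa [hne] using hfC v hv
      · rcases hcase v hv with rfl | ⟨hne, hv⟩
        · simpa [huv.ne] using hbn u huv hadj
        · have hu : u ≠ w := by
            rintro rfl
            exact absurd (Fin.lt_def.1 huv) (by simp only [w]; omega)
          simpa [hne, hu] using hf u v hv huv hadj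
  obtain ⟨f, hfC, hf⟩ := key N le_rfl
  exact ⟨f, fun v => hfC v v.2, fun u v => hf u v v.2⟩

/-- If the available labels of each vertex lie on a level of `ℕ ^ q` that weakly increases along
the order, then a proper list colouring has no edge going weakly down. -/
lemma exists_label_of_levels {N q : ℕ} (G : SimpleGraph (Fin N)) (A : ℕ → Finset (Fin q → ℕ))
    (s : ℕ → ℕ) (hs : Monotone s) (hA : ∀ j, ∀ a ∈ A j, ∑ i, a i = s j)
    (p : Fin N → ℕ) (hp : Monotone p)
    (h : ∀ v, (∃ b ∈ A (p v), ∀ u < v, b ∉ A (p u)) ∨ #(backNeighbors G v) < #(A (p v))) :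
    ∃ f : Fin N → Fin q → ℕ, (∀ v, f v ∈ A (p v)) ∧
      ∀ u v, u < v → G.Adj u v → ¬ f v ≤ f u := by
  obtain ⟨f, hfA, hf⟩ := exists_list_coloring G (fun v => A (p v)) h
  refine ⟨f, hfA, fun u v huv hadj hle => hf u v huv hadj ?_⟩
  have h1 : ∑ i, f u i ≤ ∑ i, f v i := by
    rw [hA _ _ (hfA u), hA _ _ (hfA v)]
    exact hs (hp huv.le)
  have h2 := (sum_eq_sum_iff_of_le fun i _ => hle i).1
    (le_antisymm (sum_le_sum fun i _ => hle i) h1)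
  exact funext fun i => (h2 i (mem_univ i)).symm

lemma card_piAntidiag_univ_fin (q m : ℕ) (hq : 0 < q) :
    #(piAntidiag (univ : Finset (Fin q)) m) = (m + q - 1).choose (q - 1) := by
  rw [← map_sym_eq_piAntidiag, card_map, sym_univ, card_univ, Sym.card_sym_eq_choose,
    Fintype.card_fin, show q + m - 1 = m + q - 1 by omega]
  exact Nat.choose_symm_of_eq_add (by omega)

/-- The points of `{0, …, m - 1} ^ q` can be listed by weakly increasing coordinate sum, points of
equal sum being listed by weakly increasing coordinate at `k`. -/
lemma exists_enumeration_pi {q m : ℕ} (k : Fin q) (hm : 0 < m) :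
    ∃ x : ℕ → Fin q → ℕ, (∀ j i, x j i < m) ∧ Monotone (fun j => ∑ i, x j i) ∧
      ∀ i j, i < j → j < m ^ q → x i ≠ x j ∧
        (∑ l, x i l = ∑ l, x j l → x i k ≤ x j k) := by
  have hM : 0 < m ^ q := pow_pos hm q
  let e : Fin (m ^ q) ≃ (Fin q → Fin m) := (Fintype.equivFinOfCardEq (by simp)).symm
  let key : Fin (m ^ q) → ℕ ×ₗ ℕ := fun t => toLex (∑ i, (e t i : ℕ), (e t k : ℕ))
  let r : ℕ → Fin (m ^ q) := fun j => ⟨min j (m ^ q - 1), by omega⟩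
  have hr : Monotone r := fun i j hij => Fin.mk_le_mk.2 (by omega)
  have hmono := (Tuple.monotone_sort key).comp hr
  refine ⟨fun j i => e (Tuple.sort key (r j)) i, fun j i => Fin.is_lt _, fun i j hij => ?_,
    fun i j hij hj => ⟨fun he => ?_, fun he => ?_⟩⟩
  · exact (Prod.Lex.monotone_fst _ _ (hmono hij))
  · have h1 : e (Tuple.sort key (r i)) = e (Tuple.sort key (r j)) :=
      funext fun l => Fin.ext (congrFun he l)
    have h2 := Fin.mk.inj ((Tuple.sort key).injective (e.injective h1))
    omega
  · rcases Prod.Lex.le_iff.1 (hmono hij.le) with h | h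
    · exact absurd he h.ne
    · exact h.2

/-- A sequence of `m ^ q` antichains of `{0, …, 2m - 1} ^ q`, each lying on one level, the levels
weakly increasing, and each containing a point that lies in no earlier antichain. -/
lemma exists_antichains {q m : ℕ} (hq : 0 < q) (hm : 0 < m) :
    ∃ (A : ℕ → Finset (Fin q → ℕ)) (s : ℕ → ℕ), Monotone s ∧ (∀ j, 0 < s j) ∧
      (∀ j, ∀ a ∈ A j, ∑ i, a i = s j) ∧ (∀ j, ∀ a ∈ A j, ∀ i, a i < m + m) ∧
      (∀ j, #(A j) = (m + q - 1).choose (q - 1)) ∧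
      ∀ j < m ^ q, ∃ b ∈ A j, ∀ i < j, b ∉ A i := by
  classical
  let k : Fin q := ⟨0, hq⟩
  obtain ⟨x, hxm, hxs, hx⟩ := exists_enumeration_pi k hm
  refine ⟨fun j => (piAntidiag univ m).map (addLeftEmbedding (x j)),
    fun j => ∑ i, x j i + m, fun i j hij => Nat.add_le_add_right (hxs hij) m,
    fun j => Nat.add_pos_right _ hm, ?_, ?_, ?_, ?_⟩
  · simp only [mem_map, mem_piAntidiag, addLeftEmbedding_apply]
    rintro j _ ⟨z, ⟨hz, -⟩, rfl⟩
    simp [sum_add_distrib, hz]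
  · simp only [mem_map, mem_piAntidiag, addLeftEmbedding_apply]
    rintro j _ ⟨z, ⟨hz, -⟩, rfl⟩ i
    have h1 : z i ≤ univ.sum z := single_le_sum (fun _ _ => Nat.zero_le _) (mem_univ i)
    have h2 := hxm j i
    simp only [Pi.add_apply]
    omega
  · intro j
    rw [card_map, card_piAntidiag_univ_fin q m hq]
  · intro j hj
    refine ⟨x j + Pi.single k m, mem_map.2 ⟨Pi.single k m, by simp, rfl⟩, fun i hij hmem => ?_⟩
    simp only [mem_map, mem_piAntidiag, addLeftEmbedding_apply] at hmem
    obtain ⟨z, ⟨hz, -⟩, he⟩ := hmem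
    obtain ⟨hne, hk⟩ := hx i j hij hj
    have hsum : ∑ l, x i l = ∑ l, x j l := by
      have := congrArg (fun a => ∑ l, a l) he
      simp only [Pi.add_apply, sum_add_distrib, hz, sum_pi_single', mem_univ, if_true] at this
      simpa using this
    have hle : ∀ l ∈ univ, x i l ≤ x j l := by
      intro l _
      by_cases hl : l = k
      · exact hl ▸ hk hsum
      · have := congrFun he l
        simp only [Pi.add_apply, Pi.single_eq_of_ne hl] at this
        omega
    exact hne (funext fun l => (sum_eq_sum_iff_of_le hle).1 hsum l (mem_univ l))

theorem stmt_15 (n q : ℕ) (hn : 0 < n) (heven : Even n) (hq : 2 ≤ q)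
    (N : ℕ) (G : SimpleGraph (Fin N))
    (hsize : G.edgeSet.ncard ≤ (n / 2 + q - 1).choose (q - 1) * (n / 2) ^ q) :
    ∃ col : Fin N → Fin N → Fin q, ∀ c : Fin q,
      ¬ ∃ v : Fin (n + 1) → Fin N, IsMonoPath G v ∧
        ∀ i : Fin n, col (v i.castSucc) (v i.succ) = c := by
  classical
  obtain ⟨m, rfl⟩ := heven
  have hm : 0 < m := by omega
  rw [show (m + m) / 2 = m by omega] at hsize
  obtain ⟨A, s, hs, hs0, hA, hlt, hcard, hfresh⟩ := exists_antichains (q := q) (by omega) hm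
  set d := (m + q - 1).choose (q - 1)
  have hd : 0 < d := Nat.choose_pos (by omega)
  let H : Finset (Fin N) := {v | d ≤ #(backNeighbors G v)}
  have memH : ∀ v, v ∈ H ↔ d ≤ #(backNeighbors G v) := by simp [H]
  have hsum : #H * d + ∑ v ∈ Hᶜ, #(backNeighbors G v) ≤ m ^ q * d := by
    calc _ ≤ ∑ v ∈ H, #(backNeighbors G v) + ∑ v ∈ Hᶜ, #(backNeighbors G v) := by
            gcongr
            exact card_nsmul_le_sum _ _ _ fun v hv => (memH v).1 hv
      _ = ∑ v, #(backNeighbors G v) := sum_add_sum_compl _ _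
      _ ≤ _ := (sum_card_backNeighbors_le G).trans (by rwa [mul_comm])
  let p : Fin N → ℕ := fun v => #{w ∈ H | w ≤ v}
  have hp : Monotone p := fun u v huv =>
    card_le_card (monotone_filter_right _ fun w _ hw => le_trans hw huv)
  have hpH : ∀ v, p v ≤ #H := fun v => card_filter_le _ _
  have hpos : ∀ v ∈ H, 0 < p v := fun v hv => card_pos.2 ⟨v, by simp [hv]⟩
  have hpv : ∀ v ∈ H, ∀ u < v, p u < p v := by
    intro v hv u huv
    refine card_lt_card (ssubset_iff_of_subset
      (monotone_filter_right _ fun w _ hw => le_trans hw huv.le) |>.2 ⟨v, ?_, ?_⟩)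
    · simp [hv]
    · simp [huv]
  by_cases hL : ∀ v ∈ Hᶜ, #(backNeighbors G v) = 0
  · let A' : ℕ → Finset (Fin q → ℕ) := fun j => j.casesOn {0} A
    let s' : ℕ → ℕ := fun j => j.casesOn 0 s
    have hs' : Monotone s' := monotone_nat_of_le_succ fun j => by
      cases j with
      | zero => exact Nat.zero_le _
      | succ j => exact hs j.le_succ
    have hA' : ∀ j, ∀ a ∈ A' j, ∑ i, a i = s' j := by
      rintro (_ | j) a ha
      · simp [mem_singleton.1 ha, s']
      · exact hA j a ha
    have hHle : #H ≤ m ^ q := Nat.le_of_mul_le_mul_right (by omega) hd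
    obtain ⟨f, hfA, hf⟩ := exists_label_of_levels G A' s' hs' hA' p hp fun v => by
      by_cases hv : v ∈ H
      · left
        obtain ⟨j, hj⟩ := Nat.exists_eq_add_one.2 (hpos v hv)
        have hjm : j < m ^ q := by have := hpH v; omega
        obtain ⟨b, hb, hbn⟩ := hfresh j hjm
        refine ⟨b, by rw [hj]; exact hb, fun u huv hmem => ?_⟩
        have hlt' := hpv v hv u huv
        rcases hpu : p u with _ | i
        · rw [hpu] at hmem
          have := hA j b hb
          rw [mem_singleton.1 hmem] at this
          have := hs0 j
          simp_all
        · rw [hpu] at hmem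
          exact hbn i (by omega) hmem
      · right
        rw [hL v (mem_compl.2 hv)]
        rcases p v with _ | j
        · simp [A']
        · exact (hcard j).symm ▸ hd
    refine exists_coloring_of_label (by omega) G f (fun v i => ?_) hf
    have := hfA v
    rcases hpv' : p v with _ | j
    · rw [hpv'] at this
      simp [mem_singleton.1 this, hm]
    · rw [hpv'] at this
      exact hlt j _ this i
  · push Not at hL
    obtain ⟨w, hw, hw0⟩ := hL
    have h1 : #(backNeighbors G w) ≤ ∑ v ∈ Hᶜ, #(backNeighbors G v) :=
      single_le_sum (f := fun v => #(backNeighbors G v)) (fun _ _ => Nat.zero_le _) hw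
    have hHlt : #H < m ^ q := Nat.lt_of_mul_lt_mul_right (a := d) (by omega)
    obtain ⟨f, hfA, hf⟩ := exists_label_of_levels G A s hs hA p hp fun v => by
      by_cases hv : v ∈ H
      · left
        obtain ⟨b, hb, hbn⟩ := hfresh (p v) ((hpH v).trans_lt hHlt)
        exact ⟨b, hb, fun u huv => hbn _ (hpv v hv u huv)⟩
      · right
        rw [hcard]
        exact not_le.1 fun h => hv ((memH v).2 h)
    exact exists_coloring_of_label (by omega) G f (fun v i => hlt _ _ (hfA v) i) hf
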